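/- Let Ω⁺ ⊂ ℝ³ be a bounded open set with Lipschitz boundary and let Ω⁻ = {φ > 0} \ closure(Ω⁺) be the open representative of the minimizer of the unconstrained problem. Then Ω⁻ is bounded and diam(Ω⁻) ≤ (1 + 2√3) · diam(Ω⁺). -/

import Mathlib

open MeasureTheory Real
open scoped RealInnerProductSpace

noncomputable section

abbrev E3 := EuclideanSpace ℝ (Fin 3)

/-- The Coulomb kernel in ℝ³. -/
def coul (x y : E3) : ℝ := 1 / (4 * π * ‖x - y‖)

/-- The Coulomb energy `E(Ω⁻)`. -/
def energy (Ωp Ωm : Set E3) : ℝ :=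
  (∫ x in Ωp, ∫ y in Ωp, coul x y) + (∫ x in Ωm, ∫ y in Ωm, coul x y)
    - 2 * ∫ x in Ωp, ∫ y in Ωm, coul x y

/-- Admissible configurations for the unconstrained problem. -/
def Adm (Ωp Ωm : Set E3) : Prop :=
  MeasurableSet Ωm ∧ volume (Ωp ∩ Ωm) = 0 ∧ volume Ωm < ⊤

/-- The potential `φ` generated by the charges `χ_{Ω⁺} − χ_{Ω⁻}`. -/
def potential (Ωp Ωm : Set E3) (x : E3) : ℝ :=
  ∫ y, (Set.indicator Ωp (fun _ => (1:ℝ)) y - Set.indicator Ωm (fun _ => (1:ℝ)) y) * coul x y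

/-- A bounded open set has Lipschitz boundary if near each boundary point, after
choosing a unit direction `ν`, the set is the region above the graph of a
Lipschitz function over the hyperplane orthogonal to `ν`. -/
def HasLipschitzBoundary (Ω : Set E3) : Prop :=
  ∀ x ∈ frontier Ω, ∃ (ν : E3) (ψ : E3 → ℝ) (K : NNReal) (r : ℝ),
    ‖ν‖ = 1 ∧ LipschitzWith K ψ ∧ 0 < r ∧
    ∀ (v : E3) (t : ℝ), ⟪v, ν⟫ = 0 → x + v + t • ν ∈ Metric.ball x r →
      (x + v + t • ν ∈ Ω ↔ ψ v < t)

open Set Metric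

abbrev P2 := EuclideanSpace ℝ (Fin 2)

lemma integral_disc_inv_sqrt (b : ℝ) {R : ℝ} (hR : 0 ≤ R) :
    ∫ p : P2, (if ‖p‖ < R then (√(b ^ 2 + ‖p‖ ^ 2))⁻¹ else 0)
      = 2 * π * (√(b ^ 2 + R ^ 2) - |b|) := by
  rw [integral_fun_norm_addHaar volume (fun ρ : ℝ => if ρ < R then (√(b ^ 2 + ρ ^ 2))⁻¹ else 0)]
  have hvol : (volume : Measure P2).real (ball 0 1) = π := by
    rw [measureReal_def, EuclideanSpace.volume_ball_fin_two]
    simp [pi_nonneg]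
  have hder : ∀ ρ ∈ Ioo 0 R,
      HasDerivAt (fun ρ : ℝ => √(b ^ 2 + ρ ^ 2)) (ρ * (√(b ^ 2 + ρ ^ 2))⁻¹) ρ := by
    intro ρ hρ
    have hpos : 0 < b ^ 2 + ρ ^ 2 := by have := hρ.1; positivity
    have h := (((hasDerivAt_id ρ).pow 2).const_add (b ^ 2)).sqrt hpos.ne'
    refine h.congr_deriv ?_
    have hne := (Real.sqrt_pos.2 hpos).ne'
    simp only [id, Pi.pow_apply]
    field_simp
    norm_num
  have hcont : ContinuousOn (fun ρ : ℝ => √(b ^ 2 + ρ ^ 2)) (Icc 0 R) := by fun_prop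
  have hint := intervalIntegral.integrableOn_deriv_of_nonneg hcont hder
    (fun ρ hρ => mul_nonneg hρ.1.le (by positivity))
  have hFTC := intervalIntegral.integral_eq_sub_of_hasDerivAt_of_le hR hcont hder
    ((intervalIntegrable_iff_integrableOn_Ioc_of_le hR).2 hint)
  have hI : ∫ y in Ioi (0 : ℝ), y ^ (Module.finrank ℝ P2 - 1) •
      (if y < R then (√(b ^ 2 + y ^ 2))⁻¹ else 0) = √(b ^ 2 + R ^ 2) - |b| := by
    rw [intervalIntegral.integral_of_le hR, integral_Ioc_eq_integral_Ioo] at hFTC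
    have : √(b ^ 2 + R ^ 2) - |b| = √(b ^ 2 + R ^ 2) - √(b ^ 2 + 0 ^ 2) := by
      simp [sqrt_sq_eq_abs]
    rw [this, ← hFTC, ← Ioi_inter_Iio, ← setIntegral_indicator measurableSet_Iio]
    refine setIntegral_congr_fun measurableSet_Ioi fun y _ => ?_
    by_cases hy : y < R <;> simp [hy]
  rw [hI, hvol]
  simp
  ring

lemma integral_sqrt_sub {a s : ℝ} (ha : 0 < a) (hs : 0 < s) :
    ∫ h in (-s)..s, √(s ^ 2 + a ^ 2 - 2 * h * a) = ((s + a) ^ 3 - |s - a| ^ 3) / (3 * a) := by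
  have hder : ∀ h ∈ Ioo (-s) s, HasDerivAt
      (fun h : ℝ => -((s ^ 2 + a ^ 2 - 2 * h * a) * √(s ^ 2 + a ^ 2 - 2 * h * a)) / (3 * a))
      (√(s ^ 2 + a ^ 2 - 2 * h * a)) h := by
    intro h hh
    have hpos : 0 < s ^ 2 + a ^ 2 - 2 * h * a := by nlinarith [hh.2, sq_nonneg (s - a)]
    have h1 : HasDerivAt (fun h : ℝ => s ^ 2 + a ^ 2 - 2 * h * a) (-(2 * a)) h := by
      have := (((hasDerivAt_id h).const_mul 2).mul_const a).const_sub (s ^ 2 + a ^ 2)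
      simpa using this
    have h2 := ((h1.mul (h1.sqrt hpos.ne')).neg).div_const (3 * a)
    refine h2.congr_deriv ?_
    have hsq := Real.mul_self_sqrt hpos.le
    have hne := (Real.sqrt_pos.2 hpos).ne'
    generalize √(s ^ 2 + a ^ 2 - 2 * h * a) = q at hsq hne ⊢
    rw [← hsq]
    field_simp
    ring
  have hc : Continuous fun h : ℝ => √(s ^ 2 + a ^ 2 - 2 * h * a) := by fun_prop
  rw [intervalIntegral.integral_eq_sub_of_hasDerivAt_of_le (by linarith) (by fun_prop) hder
    (hc.intervalIntegrable _ _)]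
  have e1 : s ^ 2 + a ^ 2 - 2 * s * a = (s - a) ^ 2 := by ring
  have e2 : s ^ 2 + a ^ 2 - 2 * (-s) * a = (s + a) ^ 2 := by ring
  rw [e1, e2, sqrt_sq_eq_abs, sqrt_sq_eq_abs, abs_of_pos (add_pos hs ha), ← sq_abs (s - a)]
  ring

lemma integral_abs_sub_of_le {a s : ℝ} (hs : 0 < s) (h : s ≤ a) :
    ∫ h in (-s)..s, |h - a| = 2 * a * s := by
  have : ∫ h in (-s)..s, |h - a| = ∫ h in (-s)..s, (a - h) := by
    refine intervalIntegral.integral_congr fun x hx => ?_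
    rw [uIcc_of_le (by linarith)] at hx
    rw [abs_of_nonpos (by linarith [hx.2])]; ring
  rw [this, intervalIntegral.integral_sub (by simp) (by simp)]
  simp
  ring

lemma integral_abs_sub_of_lt {a s : ℝ} (ha : 0 ≤ a) (h : a < s) :
    ∫ h in (-s)..s, |h - a| = s ^ 2 + a ^ 2 := by
  have hc : Continuous fun h : ℝ => |h - a| := by fun_prop
  rw [← intervalIntegral.integral_add_adjacent_intervals (b := a)
    (hc.intervalIntegrable _ _) (hc.intervalIntegrable _ _)]
  have e1 : ∫ h in (-s)..a, |h - a| = ∫ h in (-s)..a, (a - h) := by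
    refine intervalIntegral.integral_congr fun x hx => ?_
    rw [uIcc_of_le (by linarith)] at hx
    rw [abs_of_nonpos (by linarith [hx.2])]; ring
  have e2 : ∫ h in a..s, |h - a| = ∫ h in a..s, (h - a) := by
    refine intervalIntegral.integral_congr fun x hx => ?_
    rw [uIcc_of_le (by linarith)] at hx
    rw [abs_of_nonneg (by linarith [hx.1])]
  rw [e1, e2, intervalIntegral.integral_sub (by simp) (by simp),
    intervalIntegral.integral_sub (by simp) (by simp)]
  simp
  ring

lemma integrableOn_ball_inv_norm (s : ℝ) :
    IntegrableOn (fun x : E3 => ‖x‖⁻¹) (ball 0 s) := by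
  rw [← integrable_indicator_iff measurableSet_ball]
  have : (ball (0 : E3) s).indicator (fun x : E3 => ‖x‖⁻¹)
      = fun x => (fun ρ : ℝ => if ρ < s then ρ⁻¹ else 0) ‖x‖ := by
    ext x
    by_cases hx : ‖x‖ < s <;> simp [hx]
  rw [this, integrable_fun_norm_addHaar volume (f := fun ρ : ℝ => if ρ < s then ρ⁻¹ else 0)]
  have h0 : IntegrableOn (fun y : ℝ => y) (Ioo 0 s) :=
    (continuous_id.integrableOn_Icc (a := 0) (b := s)).mono_set Ioo_subset_Icc_self
  rw [← integrable_indicator_iff measurableSet_Ioo] at h0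
  refine (h0.integrableOn (s := Ioi 0)).congr_fun (fun y hy => ?_) measurableSet_Ioi
  have hy' : 0 < y := hy
  by_cases h : y < s
  · simp [h, hy', pow_two, hy'.ne']
  · simp [h]

/-- The value at distance `a` from its centre of the integral of `1 / |x - y|` over a ball of
radius `s`. -/
def ballNewton (s a : ℝ) : ℝ :=
  if s ≤ a then 4 * π * s ^ 3 / (3 * a) else 2 * π * (s ^ 2 - a ^ 2 / 3)

lemma integral_newton_profile {a s : ℝ} (ha : 0 ≤ a) (hs : 0 < s) :
    ∫ h in (-s)..s, 2 * π * (√(s ^ 2 + a ^ 2 - 2 * h * a) - |h - a|) = ballNewton s a := by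
  have hc : Continuous fun h : ℝ => |h - a| := by fun_prop
  have hc' : Continuous fun h : ℝ => √(s ^ 2 + a ^ 2 - 2 * h * a) := by fun_prop
  rw [intervalIntegral.integral_const_mul, intervalIntegral.integral_sub
    (hc'.intervalIntegrable _ _) (hc.intervalIntegrable _ _), ballNewton]
  split_ifs with h
  · have ha' : 0 < a := hs.trans_le h
    rw [integral_sqrt_sub ha' hs, integral_abs_sub_of_le hs h, abs_of_nonpos (by linarith)]
    field_simp
    ring
  · push Not at h
    rw [integral_abs_sub_of_lt ha h]
    rcases ha.eq_or_lt with rfl | ha'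
    · simp [sqrt_sq hs.le]
      ring
    · rw [integral_sqrt_sub ha' hs, abs_of_pos (by linarith)]
      field_simp
      ring

abbrev W3 := WithLp 2 (ℝ × P2)

lemma exists_isometry_axis (y : E3) :
    ∃ L : E3 ≃ₗᵢ[ℝ] W3, L y = WithLp.toLp 2 (‖y‖, 0) := by
  have hr : Module.finrank ℝ E3 = Module.finrank ℝ W3 := by
    rw [(WithLp.linearEquiv 2 ℝ (ℝ × P2)).finrank_eq]
    simp
  obtain ⟨L₀⟩ : Nonempty (E3 ≃ₗᵢ[ℝ] W3) :=
    ⟨((stdOrthonormalBasis ℝ E3).equiv (stdOrthonormalBasis ℝ W3) (finCongr hr))⟩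
  have hn : ‖L₀ y‖ = ‖(WithLp.toLp 2 (‖y‖, 0) : W3)‖ := by
    rw [L₀.norm_map, WithLp.prod_norm_eq_of_L2]
    simp
  exact ⟨L₀.trans (Submodule.reflection
    (ℝ ∙ (L₀ y - (WithLp.toLp 2 (‖y‖, 0) : W3)))ᗮ), Submodule.reflection_sub hn⟩

lemma integral_ball_zero_inv_norm (y : E3) {s : ℝ} (hs : 0 < s) :
    ∫ x in ball (0 : E3) s, ‖x - y‖⁻¹ = ballNewton s ‖y‖ := by
  have hint : IntegrableOn (fun x : E3 => ‖x - y‖⁻¹) (ball 0 s) := by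
    have h := (integrableOn_ball_inv_norm (s + ‖y‖))
    rw [← integrable_indicator_iff measurableSet_ball] at h
    have h2 := h.comp_sub_right y
    refine (h2.integrableOn (s := ball 0 s)).congr_fun (fun x hx => ?_) measurableSet_ball
    have : x - y ∈ ball (0 : E3) (s + ‖y‖) := by
      simp only [mem_ball_zero_iff] at hx ⊢
      linarith [norm_sub_le x y]
    simp [indicator_of_mem this]
  obtain ⟨L, hL⟩ := exists_isometry_axis y
  set a := ‖y‖
  have ha : 0 ≤ a := norm_nonneg y
  set F : ℝ × P2 → ℝ := fun q =>
    if ‖q.2‖ < √(s ^ 2 - q.1 ^ 2) then (√((q.1 - a) ^ 2 + ‖q.2‖ ^ 2))⁻¹ else 0 with hF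
  let T : E3 ≃ᵐ ℝ × P2 :=
    L.toMeasurableEquiv.trans (MeasurableEquiv.toLp 2 (ℝ × P2)).symm
  have hT : MeasurePreserving T volume volume :=
    (L.measurePreserving).trans (WithLp.volume_preserving_symm_measurableEquiv_toLp_prod ℝ P2)
  have hFT : ∀ x, F (T x) = (ball (0 : E3) s).indicator (fun x : E3 => ‖x - y‖⁻¹) x := by
    intro x
    have hTx : T x = (L x).ofLp := rfl
    have h1 : ‖x‖ ^ 2 = (L x).fst ^ 2 + ‖(L x).snd‖ ^ 2 := by
      rw [← L.norm_map x, WithLp.prod_norm_sq_eq_of_L2]; simp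
    have h2 : ‖x - y‖ ^ 2 = ((L x).fst - a) ^ 2 + ‖(L x).snd‖ ^ 2 := by
      rw [← L.norm_map (x - y), map_sub, hL, WithLp.prod_norm_sq_eq_of_L2]; simp
    have h3 : ‖x - y‖ = √(((L x).fst - a) ^ 2 + ‖(L x).snd‖ ^ 2) := by
      rw [← h2, sqrt_sq (norm_nonneg _)]
    have h4 : x ∈ ball (0 : E3) s ↔ ‖(L x).snd‖ < √(s ^ 2 - (L x).fst ^ 2) := by
      rw [mem_ball_zero_iff, lt_sqrt (norm_nonneg _), ← abs_of_pos hs, ← abs_norm x, ← sq_lt_sq,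
        h1, sq_abs]
      constructor <;> intro h <;> linarith
    rw [hTx, hF]
    by_cases hx : x ∈ ball (0 : E3) s
    · rw [indicator_of_mem hx, h3]
      exact if_pos (h4.1 hx)
    · rw [indicator_of_notMem hx]
      exact if_neg (fun h => hx (h4.2 h))
  have hFi : Integrable F := by
    rw [← hT.integrable_comp_emb T.measurableEmbedding]
    refine ((integrable_indicator_iff measurableSet_ball).2 hint).congr ?_
    exact Filter.Eventually.of_forall fun x => (hFT x).symm
  rw [← integral_indicator measurableSet_ball, ← integral_congr_ae
    (Filter.Eventually.of_forall hFT), hT.integral_comp' F]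
  rw [Measure.volume_eq_prod, integral_prod F hFi, ← integral_newton_profile ha hs,
    intervalIntegral.integral_of_le (by linarith), integral_Ioc_eq_integral_Ioo,
    ← integral_indicator measurableSet_Ioo]
  refine integral_congr_ae (Filter.Eventually.of_forall fun h => ?_)
  simp only [hF]
  rw [integral_disc_inv_sqrt _ (sqrt_nonneg _)]
  by_cases hh : h ∈ Ioo (-s) s
  · rw [indicator_of_mem hh, sq_sqrt (by nlinarith [hh.1, hh.2])]
    congr 3
    ring_nf
  · rw [indicator_of_notMem hh, sqrt_eq_zero_of_nonpos (x := s ^ 2 - h ^ 2),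
      zero_pow two_ne_zero, add_zero, sqrt_sq_eq_abs, sub_self, mul_zero]
    have : s ≤ |h| := by
      by_contra! hc
      exact hh (abs_lt.1 hc)
    nlinarith [sq_abs h, abs_nonneg h]

lemma coul_eq (x y : E3) : coul x y = (4 * π)⁻¹ * ‖x - y‖⁻¹ := by
  rw [coul, one_div, mul_inv]

lemma coul_comm (x y : E3) : coul x y = coul y x := by
  rw [coul_eq, coul_eq, norm_sub_rev]

lemma coul_nonneg (x y : E3) : 0 ≤ coul x y := by
  rw [coul]; positivity

lemma measurable_uncurry_coul : Measurable (Function.uncurry coul) := by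
  have : Measurable fun p : E3 × E3 => 1 / (4 * π * ‖p.1 - p.2‖) := by fun_prop
  exact this

lemma measurable_coul (x : E3) : Measurable (coul x) := by
  have : Measurable fun y : E3 => 1 / (4 * π * ‖x - y‖) := by fun_prop
  exact this

/-- The Coulomb potential generated by the uniform charge on `S`. -/
def pot (S : Set E3) (x : E3) : ℝ := ∫ y in S, coul x y

lemma pot_nonneg (S : Set E3) (x : E3) : 0 ≤ pot S x :=
  integral_nonneg fun y => coul_nonneg x y

lemma pot_ball (z y : E3) {s : ℝ} (hs : 0 < s) :
    pot (ball z s) y = ballNewton s ‖y - z‖ / (4 * π) := by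
  have h : ∫ x in ball z s, ‖x - y‖⁻¹ = ballNewton s ‖y - z‖ := by
    rw [← integral_ball_zero_inv_norm (y - z) hs, ← integral_indicator measurableSet_ball,
      ← integral_indicator measurableSet_ball,
      ← integral_add_right_eq_self ((ball z s).indicator fun x => ‖x - y‖⁻¹) z]
    congr 1
    ext x
    by_cases hx : ‖x‖ < s
    · simp only [indicator, mem_ball, dist_eq_norm, add_sub_cancel_right, sub_zero, if_pos hx]
      congr 2
      abel
    · simp [indicator, mem_ball, dist_eq_norm, hx]
  have h2 : pot (ball z s) y = (4 * π)⁻¹ * ∫ x in ball z s, ‖x - y‖⁻¹ := by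
    rw [pot, ← integral_const_mul]
    simp_rw [coul_eq, norm_sub_rev y]
  rw [h2, h]
  field_simp

lemma pot_ball_self (x : E3) {s : ℝ} (hs : 0 < s) : pot (ball x s) x = s ^ 2 / 2 := by
  rw [pot_ball x x hs, ballNewton, sub_self, norm_zero, if_neg (not_le.2 hs)]
  field_simp
  ring

lemma integrableOn_coul_ball (x : E3) (s : ℝ) : IntegrableOn (coul x) (ball x s) := by
  have h := integrableOn_ball_inv_norm s
  rw [← integrable_indicator_iff measurableSet_ball] at h ⊢
  refine ((h.comp_sub_right x).const_mul (4 * π)⁻¹).congr (Filter.Eventually.of_forall fun y => ?_)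
  simp [indicator, mem_ball, dist_eq_norm, coul_eq, norm_sub_rev x]

lemma coul_le_of_notMem_ball {x y : E3} {s : ℝ} (hs : 0 < s) (hy : y ∉ ball x s) :
    coul x y ≤ 1 / (4 * π * s) := by
  have : s ≤ ‖x - y‖ := by
    rw [mem_ball, not_lt, dist_comm, dist_eq_norm] at hy; exact hy
  unfold coul
  gcongr

lemma le_coul_of_mem_ball {x y : E3} {s : ℝ} (hy : y ∈ ball x s) (hne : y ≠ x) :
    1 / (4 * π * s) ≤ coul x y := by
  have h : ‖x - y‖ < s := by
    rwa [mem_ball, dist_comm, dist_eq_norm] at hy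
  have h' : 0 < ‖x - y‖ := norm_pos_iff.2 (sub_ne_zero.2 hne.symm)
  unfold coul
  gcongr

lemma integrableOn_coul {S : Set E3} (hS : volume S < ⊤) (x : E3) :
    IntegrableOn (coul x) S := by
  have h1 : IntegrableOn (coul x) (S ∩ ball x 1) :=
    (integrableOn_coul_ball x 1).mono_set inter_subset_right
  have h2 : IntegrableOn (coul x) (S \ ball x 1) := by
    refine Measure.integrableOn_of_bounded (M := 1 / (4 * π * 1))
      ((measure_mono sdiff_subset).trans_lt hS).ne (measurable_coul x).aestronglyMeasurable ?_
    have h3 : ∀ᵐ y ∂volume.restrict (S \ ball x 1), y ∈ (ball x 1)ᶜ := by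
      rw [sdiff_eq]
      exact ae_mono (Measure.restrict_mono inter_subset_right le_rfl)
        (ae_restrict_mem measurableSet_ball.compl)
    filter_upwards [h3] with y hy
    rw [norm_of_nonneg (coul_nonneg x y)]
    exact coul_le_of_notMem_ball one_pos hy
  rw [← inter_union_sdiff S (ball x 1)]
  exact h1.union h2

lemma exists_volume_le_volume_ball {S : Set E3} (hS : volume S < ⊤) :
    ∃ d : ℝ, 0 < d ∧ ∀ x : E3, volume S ≤ volume (ball x d) := by
  refine ⟨max 1 (volume S).toReal, by positivity, fun x => ?_⟩
  rw [EuclideanSpace.volume_ball_fin_three, ← ENNReal.ofReal_pow (by positivity),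
    ← ENNReal.ofReal_mul (by positivity), ← ENNReal.ofReal_toReal hS.ne]
  refine ENNReal.ofReal_le_ofReal ?_
  rw [ENNReal.toReal_ofReal ENNReal.toReal_nonneg]
  set d := max 1 (volume S).toReal
  have h1 : 1 ≤ d := le_max_left _ _
  have h2 : (volume S).toReal ≤ d := le_max_right _ _
  have h3 : d ≤ d ^ 3 := le_self_pow₀ h1 (by norm_num)
  have h4 : 1 ≤ π * 4 / 3 := by linarith [pi_gt_three]
  nlinarith

lemma pot_le_of_volume_le {S : Set E3} (hSm : MeasurableSet S) {x : E3} {d : ℝ} (hd : 0 < d)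
    (hS : volume S ≤ volume (ball x d)) : pot S x ≤ d ^ 2 / 2 := by
  have hB : volume (ball x d) < ⊤ := measure_ball_lt_top
  have hS' : volume S < ⊤ := hS.trans_lt hB
  set c := 1 / (4 * π * d)
  have hfi : ∀ T : Set E3, volume T < ⊤ → IntegrableOn (fun y => coul x y - c) T :=
    fun T hT => (integrableOn_coul hT x).sub (integrableOn_const hT.ne)
  have key : ∫ y in S, (coul x y - c) ≤ ∫ y in ball x d, (coul x y - c) := by
    rw [← integral_indicator hSm, ← integral_indicator measurableSet_ball]
    refine integral_mono_ae ((integrable_indicator_iff hSm).2 (hfi S hS'))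
      ((integrable_indicator_iff measurableSet_ball).2 (hfi _ hB)) ?_
    filter_upwards [compl_mem_ae_iff.2 (measure_singleton x)] with y hy
    by_cases hyB : y ∈ ball x d
    · rw [indicator_of_mem hyB]
      exact indicator_le_self' (fun _ _ => sub_nonneg.2 (le_coul_of_mem_ball hyB hy)) y
    · rw [indicator_of_notMem hyB]
      by_cases hyS : y ∈ S
      · rw [indicator_of_mem hyS]
        exact sub_nonpos.2 (coul_le_of_notMem_ball hd hyB)
      · rw [indicator_of_notMem hyS]
  rw [integral_sub (integrableOn_coul hS' x) (integrableOn_const hS'.ne),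
    integral_sub (integrableOn_coul hB x) (integrableOn_const hB.ne), setIntegral_const,
    setIntegral_const] at key
  have hself : ∫ y in ball x d, coul x y = d ^ 2 / 2 := pot_ball_self x hd
  have hvol : volume.real S ≤ volume.real (ball x d) := ENNReal.toReal_mono hB.ne hS
  have hc : 0 ≤ c := by positivity
  have := mul_le_mul_of_nonneg_right hvol hc
  simp only [smul_eq_mul] at key
  rw [pot]
  linarith

lemma exists_pot_le {S : Set E3} (hSm : MeasurableSet S) (hS : volume S < ⊤) :
    ∃ M, ∀ x, pot S x ≤ M := by
  obtain ⟨d, hd, h⟩ := exists_volume_le_volume_ball hS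
  exact ⟨d ^ 2 / 2, fun x => pot_le_of_volume_le hSm hd (h x)⟩

lemma integrable_coul_prod {S T : Set E3} (hS : volume S < ⊤) (hTm : MeasurableSet T)
    (hT : volume T < ⊤) :
    Integrable (Function.uncurry coul) ((volume.restrict S).prod (volume.restrict T)) := by
  obtain ⟨M, hM⟩ := exists_pot_le hTm hT
  have hmeas : AEStronglyMeasurable (Function.uncurry coul)
      ((volume.restrict S).prod (volume.restrict T)) :=
    measurable_uncurry_coul.aestronglyMeasurable
  refine (integrable_prod_iff hmeas).2
    ⟨Filter.Eventually.of_forall fun x => integrableOn_coul hT x, ?_⟩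
  refine Measure.integrableOn_of_bounded (M := M) hS.ne ?_ (Filter.Eventually.of_forall fun x => ?_)
  · exact (measurable_uncurry_coul.norm.stronglyMeasurable.integral_prod_right
      (ν := volume.restrict T)).aestronglyMeasurable
  · have h : ∫ y in T, ‖Function.uncurry coul (x, y)‖ = pot T x := by
      refine integral_congr_ae (Filter.Eventually.of_forall fun y => ?_)
      exact norm_of_nonneg (coul_nonneg x y)
    rw [h, norm_of_nonneg (pot_nonneg T x)]
    exact hM x

lemma setIntegral_pot_comm {S T : Set E3} (hS : volume S < ⊤) (hTm : MeasurableSet T)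
    (hT : volume T < ⊤) : ∫ x in S, pot T x = ∫ x in T, pot S x := by
  unfold pot
  rw [integral_integral_swap (integrable_coul_prod hS hTm hT)]
  simp_rw [coul_comm]

lemma continuous_pot {S : Set E3} (hSm : MeasurableSet S) (hS : volume S < ⊤) :
    Continuous (pot S) := by
  refine continuous_of_uniform_approx_of_continuous fun u hu => ?_
  obtain ⟨ε, hε, hεu⟩ := Metric.mem_uniformity_dist.1 hu
  obtain ⟨δ, hδ, hδε⟩ : ∃ δ : ℝ, 0 < δ ∧ δ ^ 2 / 2 < ε := by
    refine ⟨√ε, sqrt_pos.2 hε, ?_⟩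
    rw [sq_sqrt hε.le]
    linarith
  have hpos : ∀ x y : E3, 0 < 4 * π * max δ ‖x - y‖ := fun x y => by positivity
  have hk0 : ∀ x y : E3, 0 ≤ 1 / (4 * π * max δ ‖x - y‖) := fun x y => by positivity
  have hkb : ∀ x y : E3, ‖1 / (4 * π * max δ ‖x - y‖)‖ ≤ 1 / (4 * π * δ) := by
    intro x y
    rw [norm_of_nonneg (hk0 x y)]
    gcongr
    exact le_max_left _ _
  have hki : ∀ x, IntegrableOn (fun y : E3 => 1 / (4 * π * max δ ‖x - y‖)) S := fun x =>
    Measure.integrableOn_of_bounded hS.ne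
      (by fun_prop : Measurable fun y : E3 => 1 / (4 * π * max δ ‖x - y‖)).aestronglyMeasurable
      (Filter.Eventually.of_forall (hkb x))
  refine ⟨fun x => ∫ y in S, 1 / (4 * π * max δ ‖x - y‖), ?_, fun x => hεu ?_⟩
  · refine continuous_of_dominated (bound := fun _ => 1 / (4 * π * δ)) (fun x => (hki x).1)
      (fun x => Filter.Eventually.of_forall (hkb x)) (integrableOn_const hS.ne)
      (Filter.Eventually.of_forall fun y => ?_)
    exact Continuous.div continuous_const (by fun_prop) fun x => (hpos x y).ne'
  · have hcS := integrableOn_coul hS x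
    have h1 : ∀ᵐ y ∂volume.restrict S, 0 ≤ coul x y - 1 / (4 * π * max δ ‖x - y‖) := by
      refine ae_restrict_of_ae ?_
      filter_upwards [compl_mem_ae_iff.2 (measure_singleton x)] with y hy
      have : 0 < ‖x - y‖ := norm_pos_iff.2 (sub_ne_zero.2 (Ne.symm hy))
      rw [sub_nonneg, coul]
      gcongr
      exact le_max_right _ _
    have h2 : ∫ y in S, (coul x y - 1 / (4 * π * max δ ‖x - y‖)) ≤ pot (ball x δ) x := by
      rw [pot, ← integral_indicator hSm, ← integral_indicator measurableSet_ball]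
      refine integral_mono ((integrable_indicator_iff hSm).2 (hcS.sub (hki x)))
        ((integrable_indicator_iff measurableSet_ball).2 (integrableOn_coul_ball x δ)) fun y => ?_
      have hb0 : 0 ≤ (ball x δ).indicator (coul x) y :=
        indicator_nonneg (fun z _ => coul_nonneg x z) y
      by_cases hyS : y ∈ S
      · simp only [indicator_of_mem hyS]
        by_cases hyB : y ∈ ball x δ
        · rw [indicator_of_mem hyB]
          linarith [hk0 x y]
        · rw [indicator_of_notMem hyB]
          rw [mem_ball, not_lt, dist_comm, dist_eq_norm] at hyB
          rw [max_eq_right hyB, coul, sub_self]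
      · simp only [indicator_of_notMem hyS]
        exact hb0
    rw [pot_ball_self x hδ] at h2
    have h3 := integral_nonneg_of_ae h1
    rw [integral_sub hcS (hki x)] at h2 h3
    simp only [dist_eq_norm, pot]
    rw [norm_of_nonneg h3]
    exact lt_of_le_of_lt h2 hδε

lemma integrableOn_pot {S T : Set E3} (hSm : MeasurableSet S) (hS : volume S < ⊤)
    (hT : volume T < ⊤) : IntegrableOn (pot S) T := by
  obtain ⟨M, hM⟩ := exists_pot_le hSm hS
  refine Measure.integrableOn_of_bounded (M := M) hT.ne
    (continuous_pot hSm hS).aestronglyMeasurable (Filter.Eventually.of_forall fun x => ?_)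
  rw [norm_of_nonneg (pot_nonneg S x)]
  exact hM x

lemma pot_union {S T : Set E3} (hTm : MeasurableSet T) (hd : Disjoint S T)
    (hS : volume S < ⊤) (hT : volume T < ⊤) (x : E3) :
    pot (S ∪ T) x = pot S x + pot T x :=
  setIntegral_union hd hTm (integrableOn_coul hS x) (integrableOn_coul hT x)

lemma potential_eq {S T : Set E3} (hSm : MeasurableSet S) (hTm : MeasurableSet T)
    (hS : volume S < ⊤) (hT : volume T < ⊤) (x : E3) :
    potential S T x = pot S x - pot T x := by
  rw [potential, pot, pot, ← integral_indicator hSm, ← integral_indicator hTm, ← integral_sub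
    ((integrable_indicator_iff hSm).2 (integrableOn_coul hS x))
    ((integrable_indicator_iff hTm).2 (integrableOn_coul hT x))]
  congr 1
  ext y
  by_cases h1 : y ∈ S <;> by_cases h2 : y ∈ T <;> simp [h1, h2]

lemma energy_eq (S T : Set E3) :
    energy S T = (∫ x in S, pot S x) + (∫ x in T, pot T x) - 2 * ∫ x in S, pot T x := rfl

lemma energy_union {S T A : Set E3} (hSm : MeasurableSet S) (hTm : MeasurableSet T)
    (hAm : MeasurableSet A) (hS : volume S < ⊤) (hT : volume T < ⊤) (hA : volume A < ⊤)
    (hd : Disjoint T A) :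
    energy S (T ∪ A) = energy S T + ∫ x in A, (pot A x - 2 * potential S T x) := by
  have hTA := integrableOn_pot hTm hT hA
  have hAT := integrableOn_pot hAm hA hT
  have hAA := integrableOn_pot hAm hA hA
  have hTT := integrableOn_pot hTm hT hT
  have hSA := integrableOn_pot hSm hS hA
  have e1 : ∫ x in T ∪ A, pot (T ∪ A) x
      = (∫ x in T, pot T x) + 2 * (∫ x in A, pot T x) + ∫ x in A, pot A x := by
    simp_rw [pot_union hAm hd hT hA]
    have hT' : IntegrableOn (fun x => pot T x + pot A x) T := hTT.add hAT
    have hA' : IntegrableOn (fun x => pot T x + pot A x) A := hTA.add hAA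
    rw [setIntegral_union hd hAm hT' hA', integral_add hTT hAT,
      integral_add hTA hAA, setIntegral_pot_comm hT hAm hA]
    ring
  have e2 : ∫ x in S, pot (T ∪ A) x = (∫ x in S, pot T x) + ∫ x in A, pot S x := by
    simp_rw [pot_union hAm hd hT hA]
    rw [integral_add (integrableOn_pot hTm hT hS) (integrableOn_pot hAm hA hS),
      setIntegral_pot_comm hS hAm hA]
  have e3 : ∫ x in A, (pot A x - 2 * potential S T x)
      = (∫ x in A, pot A x) - 2 * ((∫ x in A, pot S x) - ∫ x in A, pot T x) := by
    simp_rw [potential_eq hSm hTm hS hT]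
    have hST : IntegrableOn (fun x => 2 * (pot S x - pot T x)) A := (hSA.sub hTA).const_mul 2
    rw [integral_sub hAA hST, integral_const_mul, integral_sub hSA hTA]
  rw [energy_eq, energy_eq, e1, e2, e3]
  ring

lemma volume_potential_pos_diff_eq_zero {S T : Set E3} (hSm : MeasurableSet S)
    (hS : volume S < ⊤) (hadm : Adm S T) (hmin : ∀ A, Adm S A → energy S T ≤ energy S A) :
    volume ({x | 0 < potential S T x} \ (S ∪ T)) = 0 := by
  obtain ⟨hTm, hST, hT⟩ := hadm
  have hcont : Continuous (potential S T) := by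
    rw [funext (potential_eq hSm hTm hS hT)]
    exact (continuous_pot hSm hS).sub (continuous_pot hTm hT)
  set A₀ := {x | 0 < potential S T x} \ (S ∪ T)
  have hA₀ : MeasurableSet A₀ :=
    (isOpen_lt continuous_const hcont).measurableSet.diff (hSm.union hTm)
  by_contra hne
  obtain ⟨p, hp, hpos⟩ := exists_mem_forall_mem_nhdsWithin_pos_measure hne
  have hp0 : 0 < potential S T p := hp.1
  set η := potential S T p / 2
  have hη : 0 < η := half_pos hp0
  have hU : IsOpen {x | η < potential S T x} := isOpen_lt continuous_const hcont
  set A := A₀ ∩ ({x | η < potential S T x} ∩ ball p (√η))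
  have hAm : MeasurableSet A := hA₀.inter (hU.measurableSet.inter measurableSet_ball)
  have hApos : 0 < volume A := by
    refine hpos A (Filter.inter_mem self_mem_nhdsWithin (mem_nhdsWithin_of_mem_nhds ?_))
    exact (hU.inter isOpen_ball).mem_nhds
      ⟨half_lt_self hp0, mem_ball_self (sqrt_pos.2 hη)⟩
  have hAball : volume A ≤ volume (ball p (√η)) :=
    measure_mono (inter_subset_right.trans inter_subset_right)
  have hA : volume A < ⊤ := hAball.trans_lt measure_ball_lt_top
  have hdTA : Disjoint T A := by
    rw [Set.disjoint_left]
    exact fun x hxT hxA => hxA.1.2 (Or.inr hxT)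
  have hadmA : Adm S (T ∪ A) := by
    refine ⟨hTm.union hAm, ?_, (measure_union_le T A).trans_lt (ENNReal.add_lt_top.2 ⟨hT, hA⟩)⟩
    have : S ∩ (T ∪ A) ⊆ S ∩ T := by
      rintro x ⟨hxS, hxT | hxA⟩
      · exact ⟨hxS, hxT⟩
      · exact absurd (Or.inl hxS) hxA.1.2
    exact measure_mono_null this hST
  have hle := hmin _ hadmA
  rw [energy_union hSm hTm hAm hS hT hA hdTA] at hle
  have hpot : ∀ x, pot A x ≤ η / 2 := by
    intro x
    have := pot_le_of_volume_le hAm (x := x) (sqrt_pos.2 hη)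
      (hAball.trans_eq (Measure.addHaar_ball_center volume p _ |>.trans
        (Measure.addHaar_ball_center volume x _).symm))
    rwa [sq_sqrt hη.le] at this
  have hint : IntegrableOn (fun x => pot A x - 2 * potential S T x) A := by
    simp_rw [potential_eq hSm hTm hS hT]
    exact (integrableOn_pot hAm hA hA).sub
      (((integrableOn_pot hSm hS hA).sub (integrableOn_pot hTm hT hA)).const_mul 2)
  have hbound : ∫ x in A, (pot A x - 2 * potential S T x) ≤ ∫ _ in A, -η := by
    refine setIntegral_mono_on hint (integrableOn_const hA.ne) hAm fun x hx => ?_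
    have h1 : η < potential S T x := hx.2.1
    linarith [hpot x]
  rw [setIntegral_const, smul_eq_mul] at hbound
  have : 0 < volume.real A := ENNReal.toReal_pos hApos.ne' hA.ne
  nlinarith

lemma pot_ball_of_le {z x : E3} {s : ℝ} (hs : 0 < s) (hx : s ≤ ‖x - z‖) :
    pot (ball z s) x = volume.real (ball z s) * coul z x := by
  rw [pot_ball z x hs, ballNewton, if_pos hx, measureReal_def,
    EuclideanSpace.volume_ball_fin_three, coul, norm_sub_rev z x]
  have : 0 < ‖x - z‖ := hs.trans_le hx
  rw [ENNReal.toReal_mul, ENNReal.toReal_pow, ENNReal.toReal_ofReal hs.le,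
    ENNReal.toReal_ofReal (by positivity)]
  field_simp

lemma pot_ball_of_lt {z x : E3} {s : ℝ} (hs : 0 < s) (hx : ‖x - z‖ < s) :
    pot (ball z s) x = s ^ 2 / 2 - ‖x - z‖ ^ 2 / 6 := by
  rw [pot_ball z x hs, ballNewton, if_neg (not_le.2 hx)]
  field_simp
  ring

lemma setIntegral_ball_potential {S T : Set E3} (hSm : MeasurableSet S) (hTm : MeasurableSet T)
    (hS : volume S < ⊤) (hT : volume T < ⊤) {z : E3} {s : ℝ} (hs : 0 < s)
    (hSB : Disjoint S (ball z s)) (hBT : volume (ball z s \ T) = 0) :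
    ∫ x in ball z s, potential S T x
      = volume.real (ball z s) * potential S T z + ∫ x in ball z s, ‖x - z‖ ^ 2 / 6 := by
  set B := ball z s
  have hBm : MeasurableSet B := measurableSet_ball
  have hB : volume B < ⊤ := measure_ball_lt_top
  have hsub : ∫ x in B, potential S T x = (∫ x in S, pot B x) - ∫ x in T, pot B x := by
    simp_rw [potential_eq hSm hTm hS hT]
    rw [integral_sub (integrableOn_pot hSm hS hB) (integrableOn_pot hTm hT hB),
      setIntegral_pot_comm hB hSm hS, setIntegral_pot_comm hB hTm hT]
  have hfar : ∀ x ∉ B, pot B x = volume.real B * coul z x := fun x hx => by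
    rw [mem_ball, not_lt, dist_eq_norm] at hx
    exact pot_ball_of_le hs hx
  have hSint : ∫ x in S, pot B x = volume.real B * pot S z := by
    rw [pot, ← integral_const_mul]
    exact setIntegral_congr_fun hSm fun x hx => hfar x (Set.disjoint_left.1 hSB hx)
  have hci : ∀ R : Set E3, volume R < ⊤ → IntegrableOn (fun x => volume.real B * coul z x) R :=
    fun R hR => (integrableOn_coul hR z).const_mul _
  have hqi : IntegrableOn (fun x : E3 => ‖x - z‖ ^ 2 / 6) B := by
    have : Continuous fun x : E3 => ‖x - z‖ ^ 2 / 6 := by fun_prop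
    exact (this.continuousOn.integrableOn_compact (isCompact_closedBall z s)).mono_set
      ball_subset_closedBall
  have hTint : (∫ x in T, pot B x) - volume.real B * pot T z
      = -∫ x in B, ‖x - z‖ ^ 2 / 6 := by
    have hBTae : (T ∩ B : Set E3) =ᵐ[volume] B := by
      refine Filter.EventuallyLE.antisymm (LE.le.eventuallyLE inter_subset_right) ?_
      refine ae_le_set.2 ?_
      rwa [inter_comm, sdiff_self_inter]
    calc (∫ x in T, pot B x) - volume.real B * pot T z
        = ∫ x in T, (pot B x - volume.real B * coul z x) := by
          rw [integral_sub (integrableOn_pot hBm hB hT) (hci T hT), integral_const_mul, pot]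
      _ = ∫ x in T ∩ B, (pot B x - volume.real B * coul z x) := by
          refine setIntegral_eq_of_subset_of_forall_sdiff_eq_zero hTm inter_subset_left ?_
          intro x hx
          rw [hfar x fun hxB => hx.2 ⟨hx.1, hxB⟩, sub_self]
      _ = ∫ x in B, (pot B x - volume.real B * coul z x) := setIntegral_congr_set hBTae
      _ = (∫ x in B, (s ^ 2 / 2 - ‖x - z‖ ^ 2 / 6)) - volume.real B * pot B z := by
          rw [integral_sub (integrableOn_pot hBm hB hB) (hci B hB), integral_const_mul]
          congr 1
          refine setIntegral_congr_fun hBm fun x hx => pot_ball_of_lt hs ?_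
          rwa [mem_ball, dist_eq_norm] at hx
      _ = -∫ x in B, ‖x - z‖ ^ 2 / 6 := by
          have hsi : IntegrableOn (fun _ : E3 => s ^ 2 / 2) B := integrableOn_const hB.ne
          rw [integral_sub hsi hqi, setIntegral_const, pot_ball_self z hs,
            smul_eq_mul]
          ring
  rw [hsub, hSint, potential_eq hSm hTm hS hT]
  linarith

lemma setIntegral_ball_sub_center_eq_zero (z : E3) (s : ℝ) :
    ∫ x in ball z s, (x - z) = 0 := by
  have h : ∫ x in ball z s, (x - z) = ∫ x in ball (0 : E3) s, x := by
    rw [← integral_indicator measurableSet_ball, ← integral_indicator measurableSet_ball,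
      ← integral_add_right_eq_self ((ball z s).indicator fun x => x - z) z]
    congr 1
    ext1 x
    simp [indicator, mem_ball, dist_eq_norm]
  have h2 : ∫ x in ball (0 : E3) s, x = -∫ x in ball (0 : E3) s, x := by
    rw [← integral_indicator measurableSet_ball, ← integral_neg,
      ← integral_neg_eq_self ((ball (0 : E3) s).indicator fun x => x)]
    congr 1
    ext1 x
    by_cases hx : ‖x‖ < s <;> simp [indicator, hx]
  rw [h]
  have h3 : (2 : ℝ) • ∫ x in ball (0 : E3) s, x = 0 := by
    rw [two_smul]
    exact eq_neg_iff_add_eq_zero.1 h2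
  simpa using h3

lemma setIntegral_ball_norm_sub_sq (z x₀ : E3) (s : ℝ) :
    ∫ x in ball z s, ‖x - x₀‖ ^ 2
      = volume.real (ball z s) * ‖z - x₀‖ ^ 2 + ∫ x in ball z s, ‖x - z‖ ^ 2 := by
  have hB : volume (ball z s) < ⊤ := measure_ball_lt_top
  have hi : ∀ f : E3 → ℝ, Continuous f → IntegrableOn f (ball z s) := fun f hf =>
    (hf.continuousOn.integrableOn_compact (isCompact_closedBall z s)).mono_set
      ball_subset_closedBall
  have hid : IntegrableOn (fun x : E3 => x - z) (ball z s) :=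
    ((by fun_prop : Continuous fun x : E3 => x - z).continuousOn.integrableOn_compact
      (isCompact_closedBall z s)).mono_set ball_subset_closedBall
  have hexp : ∀ x : E3, ‖x - x₀‖ ^ 2 = ‖x - z‖ ^ 2 + 2 * ⟪z - x₀, x - z⟫ + ‖z - x₀‖ ^ 2 := by
    intro x
    rw [← sub_add_sub_cancel x z x₀, norm_add_sq_real, real_inner_comm]
  have hin : ∫ x in ball z s, ⟪z - x₀, x - z⟫ = 0 := by
    rw [integral_inner hid, setIntegral_ball_sub_center_eq_zero, inner_zero_right]
  rw [integral_congr_ae (Filter.Eventually.of_forall hexp), integral_add (hi _ (by fun_prop)) (hi _ (by fun_prop)),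
    integral_add (hi _ (by fun_prop)) (hi _ (by fun_prop)), integral_const_mul, hin,
    setIntegral_const, smul_eq_mul]
  ring

/-- Nondegeneracy: a positive potential cannot stay bounded on a large ball away from the positive
charge. -/
lemma sq_radius_le_of_potential_pos {S T : Set E3} (hSm : MeasurableSet S)
    (hTm : MeasurableSet T) (hS : volume S < ⊤) (hT : volume T < ⊤)
    (hST : volume ({x | 0 < potential S T x} \ (S ∪ T)) = 0) {D : ℝ}
    (hD : ∀ x, potential S T x ≤ D ^ 2 / 2) {x₀ : E3} (hx₀ : 0 < potential S T x₀) {r : ℝ}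
    (hr : 0 < r) (hdisj : Disjoint S (ball x₀ r)) : r ^ 2 ≤ 3 * D ^ 2 := by
  by_contra! hlt
  have hcont : Continuous (potential S T) := by
    rw [funext (potential_eq hSm hTm hS hT)]
    exact (continuous_pot hSm hS).sub (continuous_pot hTm hT)
  set c := 3 * D ^ 2 / r ^ 2 with hc
  have hc0 : 0 ≤ c := by positivity
  have hc1 : c < 1 := (div_lt_one (by positivity)).2 hlt
  have hcr : c * r ^ 2 = 3 * D ^ 2 := by rw [hc]; field_simp
  obtain ⟨z, hzK, hz⟩ := (isCompact_closedBall x₀ r).exists_isMaxOn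
    ⟨x₀, mem_closedBall_self hr.le⟩
    (f := fun x => potential S T x - c * (‖x - x₀‖ ^ 2 / 6))
    (by fun_prop : Continuous fun x => potential S T x - c * (‖x - x₀‖ ^ 2 / 6)).continuousOn
  have hmax : ∀ x ∈ closedBall x₀ r, potential S T x - c * (‖x - x₀‖ ^ 2 / 6)
      ≤ potential S T z - c * (‖z - x₀‖ ^ 2 / 6) := fun x hx => hz hx
  have hz0 : 0 < potential S T z - c * (‖z - x₀‖ ^ 2 / 6) := by
    have := hmax x₀ (mem_closedBall_self hr.le)
    simp only [sub_self, norm_zero] at this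
    norm_num at this
    linarith
  have hzpos : 0 < potential S T z := by
    have : 0 ≤ c * (‖z - x₀‖ ^ 2 / 6) := by positivity
    linarith
  have hzr : z ∈ ball x₀ r := by
    rw [mem_closedBall, dist_eq_norm] at hzK
    rw [mem_ball, dist_eq_norm]
    refine lt_of_le_of_ne hzK fun h => ?_
    rw [h] at hz0
    linarith [hD z]
  obtain ⟨s, hs, hsub⟩ := Metric.isOpen_iff.1
    ((isOpen_lt continuous_const hcont).inter (isOpen_ball (x := x₀) (ε := r))) z ⟨hzpos, hzr⟩
  have hB : volume (ball z s) < ⊤ := measure_ball_lt_top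
  have hSB : Disjoint S (ball z s) := hdisj.mono_right fun x hx => (hsub hx).2
  have hBT : volume (ball z s \ T) = 0 := by
    refine measure_mono_null (fun x hx => ?_) hST
    refine ⟨(hsub hx.1).1, ?_⟩
    rintro (h | h)
    · exact Set.disjoint_left.1 hSB h hx.1
    · exact hx.2 h
  have hi : ∀ f : E3 → ℝ, Continuous f → IntegrableOn f (ball z s) := fun f hf =>
    (hf.continuousOn.integrableOn_compact (isCompact_closedBall z s)).mono_set
      ball_subset_closedBall
  have hle : ∫ x in ball z s, (potential S T x - c * (‖x - x₀‖ ^ 2 / 6))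
      ≤ ∫ _ in ball z s, (potential S T z - c * (‖z - x₀‖ ^ 2 / 6)) :=
    setIntegral_mono_on (hi _ (by fun_prop)) (integrableOn_const hB.ne) measurableSet_ball
      fun x hx => hmax x (ball_subset_closedBall (hsub hx).2)
  rw [integral_sub (hi _ hcont) (hi _ (by fun_prop)), integral_const_mul, integral_div,
    setIntegral_ball_potential hSm hTm hS hT hs hSB hBT, setIntegral_ball_norm_sub_sq,
    setIntegral_const, integral_div, smul_eq_mul] at hle
  have hpos : 0 < ∫ x in ball z s, ‖x - z‖ ^ 2 := by
    rw [setIntegral_pos_iff_support_of_nonneg_ae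
      (Filter.Eventually.of_forall fun x => by positivity) (hi _ (by fun_prop))]
    have h : ball z s \ {z} ⊆ (Function.support fun x => ‖x - z‖ ^ 2) ∩ ball z s := by
      rintro x ⟨hx, hxz⟩
      refine ⟨?_, hx⟩
      simpa [sub_eq_zero] using hxz
    refine lt_of_lt_of_le ?_ (measure_mono h)
    rw [measure_sdiff_null (measure_singleton z)]
    exact measure_ball_pos volume z hs
  nlinarith

lemma potential_le_sq_diam {S T : Set E3} (ho : IsOpen S) (hb : Bornology.IsBounded S)
    (hTm : MeasurableSet T) (hT : volume T < ⊤) (hne : S.Nonempty) (x : E3) :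
    potential S T x ≤ diam S ^ 2 / 2 := by
  obtain ⟨p, hp⟩ := hne
  have hS : volume S < ⊤ := hb.measure_lt_top
  have hsub : S ⊆ closedBall p (diam S) := fun y hy => dist_le_diam_of_mem hb hy hp
  have hd : 0 < diam S := by
    refine lt_of_le_of_ne diam_nonneg fun h => ?_
    rw [← h, closedBall_zero] at hsub
    exact (ho.measure_pos volume ⟨p, hp⟩).ne' (measure_mono_null hsub (measure_singleton p))
  have hvol : volume S ≤ volume (ball x (diam S)) := by
    refine (measure_mono hsub).trans_eq ?_
    rw [EuclideanSpace.volume_closedBall_fin_three, EuclideanSpace.volume_ball_fin_three]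
  rw [potential_eq ho.measurableSet hTm hS hT]
  linarith [pot_nonneg T x, pot_le_of_volume_le ho.measurableSet hd hvol]

/-- **Theorem 2.4(2)**: the open representative `Ω⁻ = {φ > 0} \ closure Ω⁺`
of the minimizer is bounded, with `diam Ω⁻ ≤ (1 + 2√3) diam Ω⁺`. -/
theorem minimizer_diameter_bound
    (Ωp : Set E3) (ho : IsOpen Ωp) (hb : Bornology.IsBounded Ωp)
    (hlip : HasLipschitzBoundary Ωp)
    (Ωm : Set E3) (hadm : Adm Ωp Ωm)
    (hmin : ∀ A, Adm Ωp A → energy Ωp Ωm ≤ energy Ωp A) :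
    Bornology.IsBounded ({x | 0 < potential Ωp Ωm x} \ closure Ωp) ∧
    Metric.diam ({x | 0 < potential Ωp Ωm x} \ closure Ωp) ≤
      (1 + 2 * Real.sqrt 3) * Metric.diam Ωp := by
  have hS : volume Ωp < ⊤ := hb.measure_lt_top
  have hnull := volume_potential_pos_diff_eq_zero ho.measurableSet hS hadm hmin
  obtain ⟨hTm, -, hT⟩ := hadm
  have hne : ∀ x, 0 < potential Ωp Ωm x → Ωp.Nonempty := by
    intro x hx
    by_contra h
    rw [not_nonempty_iff_eq_empty] at h
    rw [potential_eq ho.measurableSet hTm hS hT, h] at hx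
    have : pot ∅ x = 0 := by simp [pot]
    linarith [pot_nonneg Ωm x]
  have hinf : ∀ x, 0 < potential Ωp Ωm x → infDist x Ωp ≤ √3 * diam Ωp := by
    intro x hx
    by_contra! h
    obtain ⟨r, hr1, hr2⟩ := exists_between h
    have hd0 : 0 ≤ √3 * diam Ωp := mul_nonneg (sqrt_nonneg 3) diam_nonneg
    have hdisj : Disjoint Ωp (ball x r) :=
      (disjoint_ball_infDist.mono_left (ball_subset_ball hr2.le)).symm
    have hsq := sq_radius_le_of_potential_pos ho.measurableSet hTm hS hT hnull
      (potential_le_sq_diam ho hb hTm hT (hne x hx)) hx (hd0.trans_lt hr1) hdisj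
    have : (√3 * diam Ωp) ^ 2 = 3 * diam Ωp ^ 2 := by
      rw [mul_pow, sq_sqrt (by norm_num)]
    nlinarith
  have hdist : ∀ x ∈ {x | 0 < potential Ωp Ωm x} \ closure Ωp,
      ∀ y ∈ {x | 0 < potential Ωp Ωm x} \ closure Ωp,
        dist x y ≤ (1 + 2 * √3) * diam Ωp := by
    rintro x ⟨hx, -⟩ y ⟨hy, -⟩
    have hxq : ∀ q ∈ Ωp, dist x y - (infDist x Ωp + diam Ωp) ≤ dist y q := fun q hq => by
      linarith [dist_le_infDist_add_diam (x := x) hb hq, dist_triangle_right x y q]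
    have := (le_infDist (hne x hx)).2 hxq
    linarith [hinf x hx, hinf y hy]
  refine ⟨isBounded_iff.2 ⟨_, fun x hx y hy => hdist x hx y hy⟩,
    diam_le_of_forall_dist_le (mul_nonneg (by positivity) diam_nonneg) hdist⟩
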